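/- Let C be a plane external to the Klein quadric. Then its polar C^⊥ with respect to the Klein quadric is again a 3-dimensional subspace of ⋀²V containing no nonzero decomposable element; that is, C^⊥ is a plane external to the Klein quadric. -/

import Mathlib

open ExteriorAlgebra

variable (F : Type*) [Field F] (V : Type*) [AddCommGroup V] [Module F V]

/-- An element of the second exterior power `⋀²V` is decomposable if it is the wedge
`u ∧ v` of two vectors of `V`. -/
def IsDecomposable (x : ⋀[F]^2 V) : Prop :=
  ∃ u v : V, (x : ExteriorAlgebra F V) = ι F u * ι F v

/-- A plane external to the Klein quadric: a 3-dimensional subspace of `⋀²V` containing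
no nonzero decomposable element. -/
def IsExternalPlane (C : Submodule F ↥(⋀[F]^2 V)) : Prop :=
  Module.finrank F C = 3 ∧ ∀ x ∈ C, x ≠ 0 → ¬ IsDecomposable F V x

/-- The Plücker point `γM` of a line `M` of `P(V)`: the subspace of `⋀²V` spanned by all
wedges `u ∧ v` with `u, v ∈ M`.  For a 2-dimensional `M` this is the 1-dimensional
subspace spanned by `u ∧ v`, where `{u, v}` is any basis of `M`. -/
def plueckerPoint (M : Submodule F V) : Submodule F ↥(⋀[F]^2 V) :=
  Submodule.span F {x : ⋀[F]^2 V | ∃ u ∈ M, ∃ v ∈ M, (x : ExteriorAlgebra F V) = ι F u * ι F v}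

/-- The polar `X^⊥` of a subspace `X` of `⋀²V` with respect to the Klein quadric:
all `y` with `x ∧ y = 0` for every `x ∈ X`, the wedge being computed in the
exterior algebra of `V` (it lands in the 1-dimensional space `⋀⁴V`). -/
def polarSubspace (X : Submodule F ↥(⋀[F]^2 V)) : Submodule F ↥(⋀[F]^2 V) where
  carrier := {y | ∀ x ∈ X, (x : ExteriorAlgebra F V) * (y : ExteriorAlgebra F V) = 0}
  add_mem' := by
    intro a b ha hb x hx
    rw [Submodule.coe_add, mul_add, ha x hx, hb x hx, add_zero]
  zero_mem' := by
    intro x hx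
    simp
  smul_mem' := by
    intro c a ha x hx
    rw [Submodule.coe_smul, Algebra.mul_smul_comm, ha x hx, smul_zero]

section WedgePairing

open Module Set.powersetCard

variable {F V} {I : Type*} [LinearOrder I] [Fintype I] {m n : ℕ}

/-- The wedge pairing `⋀ᵐV × ⋀ⁿV → F`: the coordinate of `x ∧ y` along the exterior product of
all the vectors of the basis `b`. -/
noncomputable def wedgePairing (b : Basis I F V) (m n : ℕ) : ⋀[F]^m V →ₗ[F] ⋀[F]^n V →ₗ[F] F :=
  ((LinearMap.mul F (ExteriorAlgebra F V)).compl₁₂ (⋀[F]^m V).subtype (⋀[F]^n V).subtype).compr₂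
    (b.ExteriorAlgebra.coord Finset.univ)

lemma wedgePairing_apply (b : Basis I F V) (x : ⋀[F]^m V) (y : ⋀[F]^n V) :
    wedgePairing b m n x y =
      b.ExteriorAlgebra.repr ((x : ExteriorAlgebra F V) * y) Finset.univ :=
  rfl

lemma eq_zero_of_repr_univ_eq_zero (b : Basis I F V) {z : ExteriorAlgebra F V}
    (hz : z ∈ ⋀[F]^(Fintype.card I) V) (h : b.ExteriorAlgebra.repr z Finset.univ = 0) :
    z = 0 := by
  let s : Set.powersetCard I (Fintype.card I) := ⟨Finset.univ, Finset.card_univ⟩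
  have hs (t : Set.powersetCard I (Fintype.card I)) : t = s :=
    Subtype.ext (Finset.card_eq_iff_eq_univ _ |>.mp t.2)
  let _ : Unique (Set.powersetCard I (Fintype.card I)) := ⟨⟨s⟩, hs⟩
  have hsum := (b.exteriorPower (Fintype.card I)).sum_repr ⟨z, hz⟩
  rw [Fintype.sum_unique] at hsum
  have hz' : z = (b.exteriorPower (Fintype.card I)).repr ⟨z, hz⟩ s •
      b.ExteriorAlgebra Finset.univ := by
    have := congrArg Subtype.val hsum
    rw [Submodule.coe_smul, ← basis_eq_coe_basis] at this
    exact this.symm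
  rw [hz'] at h ⊢
  simp only [map_smul, Finsupp.smul_apply, Basis.repr_self, Finsupp.single_eq_same,
    smul_eq_mul, mul_one] at h
  rw [h, zero_smul]

lemma wedgePairing_eq_zero_iff (b : Basis I F V) (h : m + n = Fintype.card I)
    (x : ⋀[F]^m V) (y : ⋀[F]^n V) :
    wedgePairing b m n x y = 0 ↔ (x : ExteriorAlgebra F V) * y = 0 := by
  refine ⟨fun hxy ↦ eq_zero_of_repr_univ_eq_zero b ?_ hxy, fun hxy ↦ ?_⟩
  · rw [← h]
    exact SetLike.mul_mem_graded x.2 y.2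
  · rw [wedgePairing_apply, hxy, map_zero, Finsupp.zero_apply]

lemma wedgePairing_basis_of_ne (b : Basis I F V) (h : m + n = Fintype.card I)
    (s : Set.powersetCard I m) (t : Set.powersetCard I n) (hst : (t : Finset I) ≠ (s : Finset I)ᶜ) :
    wedgePairing b m n (b.exteriorPower m s) (b.exteriorPower n t) = 0 := by
  rw [wedgePairing_apply, ← basis_eq_coe_basis, ← basis_eq_coe_basis,
    basis_mul_of_not_disjoint, map_zero, Finsupp.zero_apply]
  intro hd
  refine hst (Finset.eq_of_subset_of_card_le ?_ ?_)
  · exact Finset.subset_compl_iff_disjoint_left.mpr hd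
  · rw [Finset.card_compl, card_eq, card_eq]
    lia

lemma wedgePairing_basis_compl (b : Basis I F V)
    (s : Set.powersetCard I m) (t : Set.powersetCard I n) (hst : (t : Finset I) = (s : Finset I)ᶜ) :
    wedgePairing b m n (b.exteriorPower m s) (b.exteriorPower n t) ≠ 0 := by
  have hd : Disjoint s.val t.val := by
    rw [hst]
    exact disjoint_compl_right
  have hu : (disjUnion hd : Finset I) = Finset.univ := by
    ext i
    have : i ∈ (t : Finset I) ↔ i ∉ (s : Finset I) := by rw [hst, Finset.mem_compl]
    simp only [coe_disjUnion, Finset.mem_disjUnion, Finset.mem_univ, iff_true]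
    exact (em (i ∈ (s : Finset I))).imp_right this.mpr
  rw [wedgePairing_apply, ← basis_eq_coe_basis, ← basis_eq_coe_basis,
    basis_mul_of_disjoint b s t hd, hu]
  rcases Int.units_eq_one_or (permOfDisjoint hd).sign with h | h <;> simp [h]

lemma wedgePairing_nondegenerate (b : Basis I F V) (h : m + n = Fintype.card I) :
    (wedgePairing b m n).Nondegenerate := by
  refine ⟨fun x hx ↦ (b.exteriorPower m).ext_elem fun s ↦ ?_,
    fun y hy ↦ (b.exteriorPower n).ext_elem fun t ↦ ?_⟩
  · let t : Set.powersetCard I n := compl ((add_comm n m).trans h) s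
    have hxt := hx (b.exteriorPower n t)
    rw [← (b.exteriorPower m).sum_repr x, map_sum, LinearMap.sum_apply, Finset.sum_eq_single s,
      map_smul, LinearMap.smul_apply, smul_eq_zero] at hxt
    · simpa using hxt.resolve_right (wedgePairing_basis_compl b s t rfl)
    · intro r _ hr
      rw [map_smul, LinearMap.smul_apply, wedgePairing_basis_of_ne b h, smul_zero]
      exact fun hrt ↦ hr (Subtype.ext (compl_injective hrt.symm))
    · simp
  · let s : Set.powersetCard I m := compl h t
    have hsy := hy (b.exteriorPower m s)
    rw [← (b.exteriorPower n).sum_repr y, map_sum, Finset.sum_eq_single t,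
      map_smul, smul_eq_zero] at hsy
    · simpa using hsy.resolve_right (wedgePairing_basis_compl b s t (compl_compl _).symm)
    · intro r _ hr
      rw [map_smul, wedgePairing_basis_of_ne b h, smul_zero]
      exact fun hrt ↦ hr (Subtype.ext (hrt.trans (compl_compl _)))
    · simp

end WedgePairing

section Decomposable

variable {F V}

/-- Left multiplication `w ↦ u ∧ w` as a map `V → ⋀²V`. -/
noncomputable def wedgeLeft (u : V) : V →ₗ[F] ⋀[F]^2 V :=
  (LinearMap.mulLeft F (ι F u) ∘ₗ ι F).codRestrict (⋀[F]^2 V) fun w ↦ by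
    rw [exteriorPower, pow_two]
    exact Submodule.mul_mem_mul (LinearMap.mem_range_self _ u) (LinearMap.mem_range_self _ w)

@[simp]
lemma coe_wedgeLeft (u w : V) : ((wedgeLeft u w : ⋀[F]^2 V) : ExteriorAlgebra F V) = ι F u * ι F w :=
  rfl

lemma ι_mul_ι_ne_zero {u w : V} (h : LinearIndependent F ![u, w]) : ι F u * ι F w ≠ 0 := by
  have hne := (exteriorPower.ιMulti_family_linearIndependent_field 2 h).ne_zero
    (Set.powersetCard.ofFinEmbEquiv (RelEmbedding.refl _))
  intro h0
  refine hne (Subtype.ext ?_)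
  simp [ExteriorAlgebra.ιMulti_apply, h0]

lemma ker_wedgeLeft_le {u : V} (hu : u ≠ 0) :
    LinearMap.ker (wedgeLeft (F := F) u) ≤ Submodule.span F {u} := by
  intro w hw
  by_contra hwu
  refine ι_mul_ι_ne_zero (F := F) (u := u) (w := w) ?_ (congrArg Subtype.val hw)
  rw [LinearIndependent.pair_iff' hu]
  exact fun a ha ↦ hwu (Submodule.mem_span_singleton.mpr ⟨a, ha⟩)

lemma finrank_le_finrank_range_wedgeLeft_add_one [FiniteDimensional F V] {u : V} (hu : u ≠ 0) :
    Module.finrank F V ≤ Module.finrank F (LinearMap.range (wedgeLeft (F := F) u)) + 1 := by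
  have h₁ := (wedgeLeft (F := F) u).finrank_range_add_finrank_ker
  have h₂ := Submodule.finrank_mono (ker_wedgeLeft_le (F := F) hu)
  rw [finrank_span_singleton hu] at h₂
  lia

lemma wedgeLeft_mul_ι_mul_ι (u v w : V) :
    ((wedgeLeft u w : ⋀[F]^2 V) : ExteriorAlgebra F V) * (ι F u * ι F v) = 0 := by
  have h : ι F u * ι F w = -(ι F w * ι F u) := eq_neg_of_add_eq_zero_left (ι_add_mul_swap u w)
  rw [coe_wedgeLeft, h, neg_mul, mul_assoc, ← mul_assoc (ι F u) (ι F u), ι_sq_zero, zero_mul,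
    mul_zero, neg_zero]

end Decomposable

/-- The polar plane `C^⊥` of a plane `C` external to the Klein quadric is again a plane
external to the Klein quadric. -/
theorem polar_of_external_plane_is_external
    [FiniteDimensional F V] (hV : Module.finrank F V = 4)
    (C : Submodule F ↥(⋀[F]^2 V)) (hC : IsExternalPlane F V C) :
    IsExternalPlane F V (polarSubspace F V C) := by
  obtain ⟨hC3, hCdec⟩ := hC
  let b : Module.Basis (Fin 4) F V := Module.finBasisOfFinrankEq F V hV
  have h4 : 2 + 2 = Fintype.card (Fin 4) := (Fintype.card_fin 4).symm
  obtain ⟨B, hB, hB0⟩ : ∃ B : LinearMap.BilinForm F (⋀[F]^2 V), B.Nondegenerate ∧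
      ∀ x y : ⋀[F]^2 V, B x y = 0 ↔ (x : ExteriorAlgebra F V) * y = 0 :=
    ⟨wedgePairing b 2 2, wedgePairing_nondegenerate b h4, wedgePairing_eq_zero_iff b h4⟩
  have h6 : Module.finrank F (⋀[F]^2 V) = 6 := by
    rw [exteriorPower.finrank_eq, hV]
    rfl
  have hpolar : polarSubspace F V C = B.orthogonal C := by
    ext y
    exact forall₂_congr fun x _ ↦ (hB0 x y).symm
  refine ⟨by rw [hpolar, LinearMap.BilinForm.finrank_orthogonal hB, h6, hC3], ?_⟩
  rintro y hy hy0 ⟨u, v, huv⟩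
  have hu : u ≠ 0 := by
    rintro rfl
    exact hy0 (Subtype.ext (by rw [huv, map_zero, zero_mul, Submodule.coe_zero]))
  let H := LinearMap.ker (B.flip y)
  have hH : Module.finrank F H < 6 := by
    rw [← h6]
    refine Submodule.finrank_lt fun hker ↦ hy0 (hB.2 y fun x ↦ ?_)
    exact LinearMap.mem_ker.mp (hker ▸ Submodule.mem_top : x ∈ H)
  have hCH : C ≤ H := fun x hx ↦ (hB0 x y).mpr (hy x hx)
  have hSH : LinearMap.range (wedgeLeft (F := F) u) ≤ H := by
    rintro _ ⟨w, rfl⟩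
    exact (hB0 (wedgeLeft u w) y).mpr (huv ▸ wedgeLeft_mul_ι_mul_ι u v w)
  have hS := finrank_le_finrank_range_wedgeLeft_add_one (F := F) hu
  have hsup := Submodule.finrank_mono (sup_le hCH hSH)
  have hadd := Submodule.finrank_sup_add_finrank_inf_eq C (LinearMap.range (wedgeLeft (F := F) u))
  have hpos : C ⊓ LinearMap.range (wedgeLeft (F := F) u) ≠ ⊥ := by
    intro hbot
    rw [hbot, finrank_bot] at hadd
    have hsum := hadd.trans (congrArg (· + _) hC3)
    lia
  obtain ⟨x, ⟨hxC, w, rfl⟩, hx0⟩ := Submodule.exists_mem_ne_zero_of_ne_bot hpos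
  exact hCdec _ hxC hx0 ⟨u, w, rfl⟩
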